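/- Let φ : ℝ^m → ℝ^{m'} be a smooth map. Then φ is a weighted morphism (i.e. f ∘ φ ∈ F_i for every i ∈ ℤ and every f ∈ F'_i) if and only if φ takes weighted paths to weighted paths (i.e. for every smooth γ : ℝ → ℝ^m with γ_a(t) = O(t^{w_a}) for all a, the composite satisfies (φ∘γ)_b(t) = O(t^{w'_b}) as t → 0 for all b). (Local coordinate model of Proposition A.1(2).) -/

import Mathlib

open Asymptotics Topology

/-- The commutative ring of smooth real-valued functions on `ℝ^m`. -/
def SmoothFns (m : ℕ) : Subring ((Fin m → ℝ) → ℝ) where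
  carrier := {f | ContDiff ℝ (⊤ : ℕ∞) f}
  mul_mem' {f g} hf hg := by
    simp only [Set.mem_setOf_eq] at *
    exact hf.mul hg
  one_mem' := by
    simp only [Set.mem_setOf_eq]
    exact contDiff_const
  add_mem' {f g} hf hg := by
    simp only [Set.mem_setOf_eq] at *
    exact hf.add hg
  zero_mem' := by
    simp only [Set.mem_setOf_eq]
    exact contDiff_const
  neg_mem' {f} hf := by
    simp only [Set.mem_setOf_eq] at *
    exact hf.neg

lemma mem_smoothFns {m : ℕ} {f : (Fin m → ℝ) → ℝ} : f ∈ SmoothFns m ↔ ContDiff ℝ (⊤ : ℕ∞) f :=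
  Iff.rfl

/-- The monomial `x ^ α` as a smooth function. -/
def monomial (m : ℕ) (α : Fin m → ℕ) : SmoothFns m :=
  ⟨fun x => ∏ a, x a ^ α a,
    mem_smoothFns.mpr <| contDiff_prod fun a _ => (contDiff_apply ℝ ℝ a).pow (α a)⟩

/-- The local model of a weighting: the ideal of smooth functions generated by the
monomials of weighted degree at least `i`. -/
def weightIdeal (m : ℕ) (w : Fin m → ℕ) (i : ℤ) : Ideal (SmoothFns m) :=
  Ideal.span {f | ∃ α : Fin m → ℕ, i ≤ ∑ a, (α a : ℤ) * (w a : ℤ) ∧ f = monomial m α}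

/-- A weighted path. -/
def IsWeightedPath (m : ℕ) (w : Fin m → ℕ) (γ : ℝ → Fin m → ℝ) : Prop :=
  ContDiff ℝ (⊤ : ℕ∞) γ ∧ ∀ a, (fun t => γ t a) =O[𝓝 (0:ℝ)] fun t => t ^ (w a)

open Set Metric in
/-- Smooth dependence on parameters of an integral over `[0,1]`. -/
lemma contDiff_paramInt_nat {E : Type} [NormedAddCommGroup E] [NormedSpace ℝ E]
    [FiniteDimensional ℝ E] (n : ℕ) :
    ∀ {G : Type} [NormedAddCommGroup G] [NormedSpace ℝ G] [CompleteSpace G]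
    (F : E × ℝ → G), ContDiff ℝ (⊤ : ℕ∞) F →
    ContDiff ℝ n (fun x => ∫ t in (0:ℝ)..1, F (x, t)) := by
  induction n with
  | zero =>
    intro G _ _ _ F hF
    have hc : Continuous F := hF.continuous
    rw [Nat.cast_zero, contDiff_zero]
    exact intervalIntegral.continuous_parametric_intervalIntegral_of_continuous'
      (f := fun x t => F (x, t)) hc 0 1
  | succ n ih =>
    intro G _ _ _ F hF
    have hc : Continuous F := hF.continuous
    let F' : E × ℝ → (E →L[ℝ] G) := fun p =>
      (fderiv ℝ F p).comp (ContinuousLinearMap.inl ℝ E ℝ)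
    have hF' : ContDiff ℝ (⊤ : ℕ∞) F' := by
      have h1 : ContDiff ℝ (⊤ : ℕ∞) (fderiv ℝ F) := hF.fderiv_right (by simp)
      exact h1.clm_comp contDiff_const
    have hc' : Continuous F' := hF'.continuous
    rw [Nat.cast_add, Nat.cast_one, contDiff_succ_iff_hasFDerivAt]
    refine ⟨fun x => ∫ t in (0:ℝ)..1, F' (x, t), ih F' hF', fun x₀ => ?_⟩
    obtain ⟨C, hC⟩ := ((isCompact_closedBall x₀ 1).prod
      (isCompact_Icc (a := (0:ℝ)) (b := 1))).exists_bound_of_continuousOn hc'.continuousOn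
    refine intervalIntegral.hasFDerivAt_integral_of_dominated_of_fderiv_le
      (F := fun x t => F (x, t)) (F' := fun x t => F' (x, t)) (bound := fun _ => C)
      (closedBall_mem_nhds x₀ one_pos) ?_ ?_ ?_ ?_ ?_ ?_
    · exact Filter.Eventually.of_forall fun x =>
        (hc.comp (by fun_prop : Continuous fun t : ℝ => (x, t))).aestronglyMeasurable
    · exact (hc.comp (by fun_prop : Continuous fun t : ℝ => (x₀, t))).intervalIntegrable _ _
    · exact (hc'.comp (by fun_prop : Continuous fun t : ℝ => (x₀, t))).aestronglyMeasurable
    · refine Filter.Eventually.of_forall fun t ht x hx => hC (x, t) ⟨hx, ?_⟩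
      rw [uIoc_of_le zero_le_one] at ht
      exact ⟨ht.1.le, ht.2⟩
    · exact intervalIntegrable_const
    · refine Filter.Eventually.of_forall fun t _ x _ => ?_
      have h1 : HasFDerivAt F (fderiv ℝ F (x, t)) (x, t) :=
        (hF.differentiable (by simp)).differentiableAt.hasFDerivAt
      exact h1.comp x (hasFDerivAt_prodMk_left x t)

lemma contDiff_paramInt {E : Type} [NormedAddCommGroup E] [NormedSpace ℝ E]
    [FiniteDimensional ℝ E] {G : Type} [NormedAddCommGroup G] [NormedSpace ℝ G] [CompleteSpace G]
    (F : E × ℝ → G) (hF : ContDiff ℝ (⊤ : ℕ∞) F) :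
    ContDiff ℝ (⊤ : ℕ∞) (fun x => ∫ t in (0:ℝ)..1, F (x, t)) :=
  contDiff_infty.2 fun n => contDiff_paramInt_nat n F hF

lemma pow_big {k l : ℕ} (h : k ≤ l) : (fun t : ℝ => t ^ l) =O[𝓝 (0:ℝ)] fun t => t ^ k := by
  obtain ⟨d, rfl⟩ := Nat.exists_eq_add_of_le h
  have h1 : (fun t : ℝ => t ^ d) =O[𝓝 (0:ℝ)] fun _ => (1:ℝ) :=
    ((continuous_pow d).tendsto 0).isBigO_one ℝ
  simpa [pow_add] using (isBigO_refl (fun t : ℝ => t ^ k) (𝓝 0)).mul h1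

/-- The weighted scaling. -/
def wscale {m : ℕ} (w : Fin m → ℕ) (t : ℝ) (x : Fin m → ℝ) : Fin m → ℝ := fun a => t ^ w a * x a

lemma contDiff_wscale {m : ℕ} (w : Fin m → ℕ) (t : ℝ) : ContDiff ℝ (⊤ : ℕ∞) (wscale w t) := by
  unfold wscale; fun_prop

lemma wscale_zero {m : ℕ} (w : Fin m → ℕ) (t : ℝ) (x : Fin m → ℝ) :
    wscale w 0 (wscale w t x) = wscale w 0 x := by
  funext a
  by_cases h : w a = 0 <;> simp [wscale, h]

lemma isWeightedPath_wscale {m : ℕ} (w : Fin m → ℕ) (x : Fin m → ℝ) :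
    IsWeightedPath m w (fun t => wscale w t x) := by
  refine ⟨?_, fun a => ?_⟩
  · unfold wscale; fun_prop
  · have := (isBigO_refl (fun t : ℝ => t ^ w a) (𝓝 0)).const_mul_left (x a)
    simpa [wscale, mul_comm] using this

/-- Restriction to the weight-zero coordinates. -/
def wres {m : ℕ} (w : Fin m → ℕ) (g : SmoothFns m) : SmoothFns m :=
  ⟨fun x => g.1 (wscale w 0 x), (mem_smoothFns.mp g.2).comp (contDiff_wscale w 0)⟩

lemma smoothFns_coe_sum {m : ℕ} {ι : Type*} (s : Finset ι) (f : ι → SmoothFns m)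
    (x : Fin m → ℝ) : (∑ i ∈ s, f i).1 x = ∑ i ∈ s, (f i).1 x := by
  have := congrFun (map_sum (SmoothFns m).subtype f s) x
  simpa using this

lemma smoothFns_coe_prod {m : ℕ} {ι : Type*} (s : Finset ι) (f : ι → SmoothFns m)
    (x : Fin m → ℝ) : (∏ i ∈ s, f i).1 x = ∏ i ∈ s, (f i).1 x := by
  have := congrFun (map_prod (SmoothFns m).subtype f s) x
  simpa using this

lemma monomial_mem {m : ℕ} (w : Fin m → ℕ) (i : ℤ) (α : Fin m → ℕ)
    (h : i ≤ ∑ a, (α a : ℤ) * (w a : ℤ)) : monomial m α ∈ weightIdeal m w i :=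
  Ideal.subset_span ⟨α, h, rfl⟩

lemma weightIdeal_mono {m : ℕ} (w : Fin m → ℕ) {i j : ℤ} (h : i ≤ j) :
    weightIdeal m w j ≤ weightIdeal m w i := by
  refine Ideal.span_mono ?_
  rintro f ⟨α, h1, rfl⟩
  exact ⟨α, h.trans h1, rfl⟩

lemma mem_weightIdeal_zero {m : ℕ} (w : Fin m → ℕ) (f : SmoothFns m) :
    f ∈ weightIdeal m w 0 := by
  have h1 : monomial m 0 ∈ weightIdeal m w 0 := monomial_mem w 0 0 (by simp)
  have h2 : monomial m 0 = 1 := by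
    apply Subtype.ext; funext x; simp [monomial]
  rw [h2] at h1
  simpa using Ideal.mul_mem_left _ f h1

lemma mul_mem_weightIdeal {m : ℕ} (w : Fin m → ℕ) {i j : ℤ} {f g : SmoothFns m}
    (hf : f ∈ weightIdeal m w i) (hg : g ∈ weightIdeal m w j) :
    f * g ∈ weightIdeal m w (i + j) := by
  have h := Ideal.mul_mem_mul hf hg
  unfold weightIdeal at h
  rw [Ideal.span_mul_span'] at h
  refine Ideal.span_mono ?_ h
  rintro _ ⟨_, ⟨α, h1, rfl⟩, _, ⟨β, h2, rfl⟩, rfl⟩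
  refine ⟨α + β, ?_, ?_⟩
  · simp only [Pi.add_apply, Nat.cast_add, add_mul, Finset.sum_add_distrib]
    exact add_le_add h1 h2
  · apply Subtype.ext; funext x
    simp [monomial, pow_add, Finset.prod_mul_distrib]

lemma monomial_single {m : ℕ} (a : Fin m) (x : Fin m → ℝ) :
    (monomial m (Pi.single a 1)).1 x = x a := by
  simp only [monomial]
  rw [Finset.prod_eq_single a]
  · simp
  · intro b _ hb; simp [hb]
  · simp

lemma monomial_single_mem {m : ℕ} (w : Fin m → ℕ) (a : Fin m) :
    monomial m (Pi.single a 1) ∈ weightIdeal m w (w a) := by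
  refine monomial_mem w _ _ ?_
  rw [Finset.sum_eq_single a]
  · simp
  · intro b _ hb; simp [hb]
  · simp

/-- Hadamard's lemma. -/
lemma sub_wres_mem {m : ℕ} (w : Fin m → ℕ) (g : SmoothFns m) :
    g - wres w g ∈ weightIdeal m w 1 := by
  have hg : ContDiff ℝ (⊤ : ℕ∞) g.1 := g.2
  let d : (Fin m → ℝ) → (Fin m → ℝ) := fun x => x - wscale w 0 x
  have hd : ContDiff ℝ (⊤ : ℕ∞) d := contDiff_id.sub (contDiff_wscale w 0)
  let F : (Fin m → ℝ) × ℝ → ((Fin m → ℝ) →L[ℝ] ℝ) := fun p =>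
    fderiv ℝ g.1 (wscale w 0 p.1 + p.2 • d p.1)
  have hF : ContDiff ℝ (⊤ : ℕ∞) F := by
    have h1 : ContDiff ℝ (⊤ : ℕ∞) (fderiv ℝ g.1) := hg.fderiv_right (by simp)
    exact h1.comp (((contDiff_wscale w 0).comp contDiff_fst).add
      (contDiff_snd.smul (hd.comp contDiff_fst)))
  let G : (Fin m → ℝ) → ((Fin m → ℝ) →L[ℝ] ℝ) := fun x => ∫ t in (0:ℝ)..1, F (x, t)
  have hG : ContDiff ℝ (⊤ : ℕ∞) G := contDiff_paramInt F hF
  have key : ∀ x, g.1 x - g.1 (wscale w 0 x) = G x (d x) := by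
    intro x
    have hcF : Continuous fun t : ℝ => F (x, t) :=
      hF.continuous.comp (by fun_prop : Continuous fun t : ℝ => (x, t))
    have h1 : ∀ t ∈ Set.uIcc (0:ℝ) 1,
        HasDerivAt (fun t : ℝ => g.1 (wscale w 0 x + t • d x)) (F (x, t) (d x)) t := by
      intro t _
      have h2 : HasFDerivAt g.1 (F (x, t)) (wscale w 0 x + t • d x) :=
        (hg.differentiable (by simp)).differentiableAt.hasFDerivAt
      have h3 : HasDerivAt (fun t : ℝ => wscale w 0 x + t • d x) (d x) t := by
        simpa using ((hasDerivAt_id t).smul_const (d x)).const_add (wscale w 0 x)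
      exact h2.comp_hasDerivAt t h3
    have h4 := intervalIntegral.integral_eq_sub_of_hasDerivAt h1
      ((hcF.clm_apply continuous_const).intervalIntegrable _ _)
    have h5 := ContinuousLinearMap.intervalIntegral_apply (hcF.intervalIntegrable (μ := MeasureTheory.volume) 0 1) (d x)
    simp only [G]
    rw [h5, h4]
    simp [d]
  let c : Fin m → SmoothFns m := fun a =>
    ⟨fun x => G x (Pi.single a 1), hG.clm_apply contDiff_const⟩
  have hsum : g - wres w g =
      ∑ a, if w a = 0 then 0 else c a * monomial m (Pi.single a 1) := by
    apply Subtype.ext; funext x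
    rw [smoothFns_coe_sum]
    change g.1 x - g.1 (wscale w 0 x) = _
    rw [key x]
    conv_lhs => rw [pi_eq_sum_univ' (d x), map_sum]
    refine Finset.sum_congr rfl fun a _ => ?_
    rw [map_smul]
    by_cases h : w a = 0
    · simp [h, d, wscale]
    · have h6 : (c a * monomial m (Pi.single a 1)).1 x = G x (Pi.single a 1) * x a := by
        change (c a).1 x * (monomial m (Pi.single a 1)).1 x = _
        rw [monomial_single]
      rw [if_neg h, h6]
      simp [h, d, wscale, mul_comm]
  rw [hsum]
  refine Ideal.sum_mem _ fun a _ => ?_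
  split_ifs with h
  · exact zero_mem _
  · exact Ideal.mul_mem_left _ _ (weightIdeal_mono w (by omega) (monomial_single_mem w a))

/-- Leading homogeneous part. -/
lemma exists_leading {m : ℕ} (w : Fin m → ℕ) (k : ℕ) (f : SmoothFns m)
    (hf : f ∈ weightIdeal m w k) :
    ∃ p : SmoothFns m, (∀ t x, p.1 (wscale w t x) = t ^ k * p.1 x) ∧
      f - p ∈ weightIdeal m w (k + 1) := by
  unfold weightIdeal at hf
  induction hf using Submodule.span_induction with
  | mem f h =>
    obtain ⟨α, h, rfl⟩ := h
    rcases h.eq_or_lt with h | h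
    · refine ⟨monomial m α, fun t x => ?_, by simp⟩
      have hk : k = ∑ a, w a * α a := by
        zify; simpa [mul_comm] using h
      simp only [monomial, wscale, mul_pow, Finset.prod_mul_distrib, ← pow_mul]
      rw [Finset.prod_pow_eq_pow_sum, hk]
    · refine ⟨0, fun t x => ?_, ?_⟩
      · change (0:ℝ) = t ^ k * 0
        simp
      · rw [sub_zero]; exact monomial_mem w _ α (by omega)
  | zero =>
    refine ⟨0, fun t x => ?_, by simp⟩
    change (0:ℝ) = t ^ k * 0
    simp
  | add f g hf hg h1 h2 =>
    obtain ⟨p, hp, hp'⟩ := h1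
    obtain ⟨q, hq, hq'⟩ := h2
    refine ⟨p + q, fun t x => ?_, ?_⟩
    · change p.1 _ + q.1 _ = t ^ k * (p.1 x + q.1 x)
      rw [hp, hq]; ring
    · have := add_mem hp' hq'
      convert this using 1; ring
  | smul g f hf h =>
    obtain ⟨p, hp, hp'⟩ := h
    refine ⟨wres w g * p, fun t x => ?_, ?_⟩
    · change g.1 (wscale w 0 (wscale w t x)) * p.1 _ = t ^ k * (g.1 (wscale w 0 x) * p.1 x)
      rw [wscale_zero, hp]; ring
    · have hpk : p ∈ weightIdeal m w k := by
        have h1 := weightIdeal_mono w (by omega : (k:ℤ) ≤ k + 1) hp'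
        have h2 := sub_mem (show f ∈ weightIdeal m w k from hf) h1
        simpa using h2
      have h3 := mul_mem_weightIdeal w (sub_wres_mem w g) hpk
      rw [add_comm (1:ℤ)] at h3
      have h4 := add_mem h3 (Ideal.mul_mem_left _ g hp')
      convert h4 using 1
      rw [smul_eq_mul]; ring

lemma isBigO_of_mem {m : ℕ} (w : Fin m → ℕ) (k : ℕ) (f : SmoothFns m)
    (hf : f ∈ weightIdeal m w k) (γ : ℝ → Fin m → ℝ) (hγ : IsWeightedPath m w γ) :
    (fun t => f.1 (γ t)) =O[𝓝 (0:ℝ)] fun t => t ^ k := by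
  unfold weightIdeal at hf
  induction hf using Submodule.span_induction with
  | mem f h =>
    obtain ⟨α, h, rfl⟩ := h
    have h1 : (fun t => ∏ a, γ t a ^ α a) =O[𝓝 (0:ℝ)] fun t => ∏ a, (t ^ w a) ^ α a :=
      IsBigO.finsetProd fun a _ => (hγ.2 a).pow (α a)
    refine h1.trans ?_
    have hk : k ≤ ∑ a, w a * α a := by
      zify; simpa [mul_comm] using h
    simp only [← pow_mul, Finset.prod_pow_eq_pow_sum]
    exact pow_big hk
  | zero => exact isBigO_zero _ _
  | add f g hf hg h1 h2 => exact h1.add h2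
  | smul g f hf h =>
    have h1 : (fun t => g.1 (γ t)) =O[𝓝 (0:ℝ)] fun _ => (1:ℝ) :=
      (((mem_smoothFns.mp g.2).continuous.comp hγ.1.continuous).tendsto 0).isBigO_one ℝ
    have := h1.mul h
    simpa using this

lemma mem_of_isBigO {m : ℕ} (w : Fin m → ℕ) (f : SmoothFns m) (k : ℕ)
    (h : ∀ γ, IsWeightedPath m w γ → (fun t => f.1 (γ t)) =O[𝓝 (0:ℝ)] fun t => t ^ k) :
    f ∈ weightIdeal m w k := by
  induction k with
  | zero => exact mem_weightIdeal_zero w f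
  | succ k ih =>
    have hpow : (fun t : ℝ => t ^ (k+1)) =O[𝓝 (0:ℝ)] fun t => t ^ k :=
      pow_big (Nat.le_succ k)
    obtain ⟨p, hp, hp'⟩ := exists_leading w k f (ih fun γ hγ => (h γ hγ).trans hpow)
    have hp0 : p = 0 := by
      apply Subtype.ext; funext x
      change p.1 x = 0
      have h1 := h _ (isWeightedPath_wscale w x)
      have h2 := isBigO_of_mem w (k+1) (f - p) (by exact_mod_cast hp') _
        (isWeightedPath_wscale w x)
      have h3 := h1.sub h2
      have h4 : (fun t : ℝ => t ^ k * p.1 x) =O[𝓝 (0:ℝ)] fun t => t ^ (k+1) := by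
        refine h3.congr_left fun t => ?_
        rw [← hp]
        change f.1 _ - (f.1 _ - p.1 _) = _
        ring
      obtain ⟨C, hC⟩ := h4.bound
      have h5 : ∀ᶠ t in 𝓝[≠] (0:ℝ), ‖p.1 x‖ ≤ C * ‖t‖ := by
        filter_upwards [hC.filter_mono nhdsWithin_le_nhds, self_mem_nhdsWithin] with t ht ht0
        have ht1 : 0 < ‖t ^ k‖ := norm_pos_iff.2 (pow_ne_zero _ ht0)
        rw [norm_mul, pow_succ, norm_mul] at ht
        nlinarith
      have h6 : Filter.Tendsto (fun t : ℝ => C * ‖t‖) (𝓝[≠] 0) (𝓝 0) := by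
        have : Continuous fun t : ℝ => C * ‖t‖ := by fun_prop
        simpa using (this.tendsto 0).mono_left nhdsWithin_le_nhds
      exact norm_le_zero_iff.1 (ge_of_tendsto h6 h5)
    rw [hp0, sub_zero] at hp'
    exact_mod_cast hp'

/-- A smooth map `φ : ℝ^m → ℝ^{m'}` is a weighted morphism (pullback preserves
the weighting filtrations) if and only if it takes weighted paths to weighted paths. -/
theorem weightedMorphism_iff_maps_weightedPaths
    (m m' : ℕ) (w : Fin m → ℕ) (w' : Fin m' → ℕ)
    (φ : (Fin m → ℝ) → (Fin m' → ℝ)) (hφ : ContDiff ℝ (⊤ : ℕ∞) φ) :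
    (∀ i : ℤ, ∀ f : SmoothFns m', f ∈ weightIdeal m' w' i →
        (⟨(f : (Fin m' → ℝ) → ℝ) ∘ φ, mem_smoothFns.mpr ((mem_smoothFns.mp f.2).comp hφ)⟩ :
          SmoothFns m) ∈ weightIdeal m w i)
      ↔ ∀ γ : ℝ → Fin m → ℝ, IsWeightedPath m w γ →
          IsWeightedPath m' w' fun t => φ (γ t) := by
  constructor
  · intro h γ hγ
    refine ⟨hφ.comp hγ.1, fun b => ?_⟩
    have h1 := isBigO_of_mem w (w' b) _ (h _ _ (monomial_single_mem w' b)) γ hγ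
    simpa only [Function.comp, monomial_single] using h1
  · intro h i f hf
    let c : Fin m' → SmoothFns m := fun b => ⟨fun x => φ x b, (contDiff_pi.1 hφ) b⟩
    have hc : ∀ b, c b ∈ weightIdeal m w (w' b) := fun b =>
      mem_of_isBigO w (c b) (w' b) fun γ hγ => (h γ hγ).2 b
    have hpow : ∀ b (n : ℕ), c b ^ n ∈ weightIdeal m w ((n : ℤ) * (w' b : ℤ)) := by
      intro b n
      induction n with
      | zero => simpa using mem_weightIdeal_zero w 1
      | succ n ih =>
        rw [pow_succ]
        have := mul_mem_weightIdeal w ih (hc b)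
        convert this using 1
        push_cast; ring
    have hprod : ∀ (β : Fin m' → ℕ) (s : Finset (Fin m')),
        ∏ b ∈ s, c b ^ β b ∈ weightIdeal m w (∑ b ∈ s, (β b : ℤ) * (w' b : ℤ)) := by
      intro β s
      induction s using Finset.induction_on with
      | empty => simpa using mem_weightIdeal_zero w 1
      | insert a s ha ih =>
        rw [Finset.prod_insert ha, Finset.sum_insert ha]
        exact mul_mem_weightIdeal w (hpow a (β a)) ih
    unfold weightIdeal at hf
    induction hf using Submodule.span_induction with
    | mem f h =>
      obtain ⟨β, h, rfl⟩ := h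
      have h1 := weightIdeal_mono w h (hprod β Finset.univ)
      convert h1 using 1
      apply Subtype.ext; funext x
      rw [smoothFns_coe_prod]
      rfl
    | zero => exact zero_mem _
    | add f g hf hg h1 h2 => exact add_mem h1 h2
    | smul g f hf h =>
      exact Ideal.mul_mem_left _ (⟨g.1 ∘ φ, mem_smoothFns.mpr ((mem_smoothFns.mp g.2).comp hφ)⟩ :
          SmoothFns m) h
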